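/- If there exist additive subgroups of F_q^{2n_1} and F_q^{2n_2} defining pure subsystem codes with parameters [[n_1,k_1,r_1,d_1]]_q and [[n_2,k_2,r_2,d_2]]_q respectively, then there exists an additive subgroup of F_q^{2(n_1+n_2)} defining a pure subsystem code with parameters [[n_1+n_2, k_1+k_2, r_1+r_2, d]]_q where d ≥ min{d_1, d_2}. -/

import Mathlib

open Matrix
open scoped Classical

/-- The symplectic vector space `F_q^{2n}`: pairs `(x|y)` with `x, y ∈ F_q^n`. -/
abbrev SV (F : Type*) (n : ℕ) := (Fin n → F) × (Fin n → F)

/-- The symplectic weight `swt(x|y) = #{i : (x_i, y_i) ≠ (0,0)}`. -/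
noncomputable def swt {F : Type*} [Zero F] {n : ℕ} (v : SV F n) : ℕ :=
  Nat.card {i : Fin n // v.1 i ≠ 0 ∨ v.2 i ≠ 0}

/-- minimum symplectic weight of a nonzero element of a set -/
noncomputable def swtSet {F : Type*} [Zero F] {n : ℕ} (S : Set (SV F n)) : ℕ :=
  sInf (swt '' {v | v ∈ S ∧ v ≠ 0})

/-- The trace-symplectic form `⟨u|v⟩ₛ = Tr_{q/p}(v₁·u₂ − u₁·v₂)`. -/
noncomputable def trSymp (p : ℕ) {F : Type*} [Field F] [Fintype F] [CharP F p] {n : ℕ}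
    (u v : SV F n) : ZMod p :=
  letI := ZMod.algebra F p
  Algebra.trace (ZMod p) F (dotProduct v.1 u.2 - dotProduct u.1 v.2)

/-- The trace-symplectic dual of a subset of `F_q^{2n}`. -/
def sdual (p : ℕ) {F : Type*} [Field F] [Fintype F] [CharP F p] {n : ℕ}
    (S : Set (SV F n)) : Set (SV F n) :=
  {v | ∀ w ∈ S, trSymp p v w = 0}

/-- `C` defines a subsystem code with parameters `((n,K,R,d))_q`, where
`K = q^n/(|C||D|)^{1/2}`, `R = (|C|/|D|)^{1/2}` for `D = C ∩ C^⊥s`, and `d` is the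
symplectic weight of `D^⊥s \ C` (resp. of `D^⊥s` if `D^⊥s = C`). -/
def IsSubsystemCode (p : ℕ) {F : Type*} [Field F] [Fintype F] [CharP F p] {n : ℕ}
    (K R d : ℕ) (C : AddSubgroup (SV F n)) : Prop :=
  C ≠ ⊥ ∧
  K ^ 2 * (Nat.card C * Nat.card ↥((C : Set (SV F n)) ∩ sdual p (C : Set (SV F n)))) =
    Fintype.card F ^ (2 * n) ∧
  R ^ 2 * Nat.card ↥((C : Set (SV F n)) ∩ sdual p (C : Set (SV F n))) = Nat.card C ∧
  d = if sdual p ((C : Set (SV F n)) ∩ sdual p (C : Set (SV F n))) = (C : Set (SV F n))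
      then swtSet (sdual p ((C : Set (SV F n)) ∩ sdual p (C : Set (SV F n))))
      else swtSet (sdual p ((C : Set (SV F n)) ∩ sdual p (C : Set (SV F n))) \ (C : Set (SV F n)))

/-- The subsystem code defined by `C` is pure to `d'`, i.e. `swt(D^⊥s) ≥ d'`. -/
def PureTo (p : ℕ) {F : Type*} [Field F] [Fintype F] [CharP F p] {n : ℕ}
    (d' : ℕ) (C : AddSubgroup (SV F n)) : Prop :=
  d' ≤ swtSet (sdual p ((C : Set (SV F n)) ∩ sdual p (C : Set (SV F n))))

/-- The `F`-bilinear symplectic form whose trace is `trSymp`. -/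
def sympForm {F : Type*} [Field F] {n : ℕ} (u v : SV F n) : F :=
  v.1 ⬝ᵥ u.2 - u.1 ⬝ᵥ v.2

section SympForm

variable {F : Type*} [Field F] {n : ℕ}

lemma sympForm_add_left (u u' v : SV F n) :
    sympForm (u + u') v = sympForm u v + sympForm u' v := by
  simp only [sympForm, Prod.fst_add, Prod.snd_add, dotProduct_add, add_dotProduct]; ring

lemma sympForm_smul_left (a : F) (u v : SV F n) :
    sympForm (a • u) v = a * sympForm u v := by
  simp only [sympForm, Prod.smul_fst, Prod.smul_snd, dotProduct_smul, smul_dotProduct,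
    smul_eq_mul]; ring

lemma sympForm_swap (u v : SV F n) : sympForm u v = -sympForm v u := by
  simp only [sympForm]; ring

lemma sympForm_self (u : SV F n) : sympForm u u = 0 := by
  simp only [sympForm, sub_self]

lemma sympForm_add_right (u v v' : SV F n) :
    sympForm u (v + v') = sympForm u v + sympForm u v' := by
  rw [sympForm_swap, sympForm_add_left, sympForm_swap v, sympForm_swap v']; ring

lemma sympForm_smul_right (a : F) (u v : SV F n) :
    sympForm u (a • v) = a * sympForm u v := by
  rw [sympForm_swap, sympForm_smul_left, sympForm_swap v]; ring

/-- The symplectic transvection `v ↦ v + c ω(v, u) u`. -/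
def transvec (c : F) (u : SV F n) : SV F n ≃+ SV F n where
  toFun v := v + (c * sympForm v u) • u
  invFun v := v + (-c * sympForm v u) • u
  left_inv v := by
    simp only [sympForm_add_left, sympForm_smul_left, sympForm_self]
    module
  right_inv v := by
    simp only [sympForm_add_left, sympForm_smul_left, sympForm_self]
    module
  map_add' v w := by
    simp only [sympForm_add_left]
    module

lemma transvec_apply (c : F) (u v : SV F n) :
    transvec c u v = v + (c * sympForm v u) • u := rfl

lemma sympForm_transvec (c : F) (u v w : SV F n) :
    sympForm (transvec c u v) (transvec c u w) = sympForm v w := by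
  simp only [transvec_apply, sympForm_add_left, sympForm_add_right, sympForm_smul_left,
    sympForm_smul_right, sympForm_self, sympForm_swap u w]
  ring

lemma sympForm_transvec_right (c : F) (u v : SV F n) :
    sympForm (transvec c u v) u = sympForm v u := by
  simp only [transvec_apply, sympForm_add_left, sympForm_smul_left, sympForm_self]
  ring

/-- The set of coordinates where a vector of `F_q^{2n}` is nonzero. -/
noncomputable def sympSupport (v : SV F n) : Finset (Fin n) :=
  Finset.univ.filter fun i => v.1 i ≠ 0 ∨ v.2 i ≠ 0

lemma mem_sympSupport {v : SV F n} {i : Fin n} :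
    i ∈ sympSupport v ↔ v.1 i ≠ 0 ∨ v.2 i ≠ 0 := by
  simp [sympSupport]

lemma notMem_sympSupport {v : SV F n} {i : Fin n} :
    i ∉ sympSupport v ↔ v.1 i = 0 ∧ v.2 i = 0 := by
  rw [mem_sympSupport]; tauto

lemma swt_eq_card (v : SV F n) : swt v = (sympSupport v).card := by
  rw [swt, Nat.card_eq_fintype_card, Fintype.card_subtype, sympSupport]

lemma swt_pos {v : SV F n} (hv : v ≠ 0) : 0 < swt v := by
  rw [swt_eq_card, Finset.card_pos, Finset.nonempty_iff_ne_empty]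
  intro h
  apply hv
  have key : ∀ i, v.1 i = 0 ∧ v.2 i = 0 := fun i => by
    rw [← notMem_sympSupport, h]; simp
  exact Prod.ext (funext fun i => (key i).1) (funext fun i => (key i).2)

lemma sympForm_eq_zero_of_disjoint {u v : SV F n}
    (h : Disjoint (sympSupport u) (sympSupport v)) : sympForm u v = 0 := by
  rw [sympForm, dotProduct, dotProduct, ← Finset.sum_sub_distrib]
  refine Finset.sum_eq_zero fun i _ => ?_
  by_cases hi : i ∈ sympSupport u
  · obtain ⟨h1, h2⟩ := notMem_sympSupport.1 (Finset.disjoint_left.1 h hi)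
    simp [h1, h2]
  · obtain ⟨h1, h2⟩ := notMem_sympSupport.1 hi
    simp [h1, h2]

/-- A transvection supported on `J` lowers the weight by less than `|J|`. -/
lemma swt_lt_swt_transvec_add_card (c : F) {u : SV F n} {J : Finset (Fin n)}
    (hJ : J.Nonempty) (hu : sympSupport u ⊆ J) (v : SV F n) :
    swt v < swt (transvec c u v) + J.card := by
  by_cases h : Disjoint (sympSupport (transvec c u v)) J
  · have h0 : sympForm v u = 0 := by
      rw [← sympForm_transvec_right c]
      exact sympForm_eq_zero_of_disjoint (h.mono_right hu)
    have : transvec c u v = v := by simp [transvec_apply, h0]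
    rw [this]
    have := hJ.card_pos
    omega
  · rw [swt_eq_card, swt_eq_card]
    have hsub : sympSupport v ⊆ (sympSupport (transvec c u v) \ J) ∪ J := by
      intro i hi
      by_cases hiJ : i ∈ J
      · simp [hiJ]
      · obtain ⟨h1, h2⟩ := notMem_sympSupport.1 fun hh => hiJ (hu hh)
        rw [mem_sympSupport] at hi
        simpa [hiJ, mem_sympSupport, transvec_apply, h1, h2] using hi
    have hlt : (sympSupport (transvec c u v) \ J).card < (sympSupport (transvec c u v)).card := by
      refine Finset.card_lt_card ?_
      rw [Finset.ssubset_iff_subset_ne]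
      exact ⟨Finset.sdiff_subset, fun hh => h (Finset.sdiff_eq_self_iff_disjoint.1 hh)⟩
    have := (Finset.card_le_card hsub).trans (Finset.card_union_le _ _)
    omega

/-- Some transvection supported on a given part `J` of the support of `b` moves `b` to a vector
with a single nonzero coordinate in `J`. -/
lemma exists_transvec_swt_add_card_le {b : SV F n} {J : Finset (Fin n)} (hJ : J.Nonempty)
    (hb : J ⊆ sympSupport b) :
    ∃ u : SV F n, sympSupport u ⊆ J ∧ swt (transvec 1 u b) + J.card ≤ swt b + 1 := by
  obtain ⟨i, hi⟩ := hJ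
  obtain ⟨α, β, hαβ⟩ : ∃ α β : F, α * b.2 i - b.1 i * β = 1 := by
    rcases mem_sympSupport.1 (hb hi) with h | h
    · exact ⟨0, -(b.1 i)⁻¹, by field_simp; ring⟩
    · exact ⟨(b.2 i)⁻¹, 0, by field_simp; ring⟩
  let w : SV F n := (Pi.single i α, Pi.single i β)
  let bJ : SV F n := (fun k => if k ∈ J then b.1 k else 0, fun k => if k ∈ J then b.2 k else 0)
  have hw : sympForm b w = 1 := by
    simpa [sympForm, w] using hαβ
  have hbJ : sympForm b bJ = 0 := by
    rw [sympForm, dotProduct, dotProduct, ← Finset.sum_sub_distrib]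
    refine Finset.sum_eq_zero fun k _ => ?_
    by_cases hk : k ∈ J <;> simp [bJ, hk, mul_comm]
  have hform : sympForm b (w + (-1 : F) • bJ) = 1 := by
    rw [sympForm_add_right, sympForm_smul_right, hw, hbJ]; ring
  refine ⟨w + (-1 : F) • bJ, fun k hk => ?_, ?_⟩
  · by_contra hkJ
    have hki : k ≠ i := fun h => hkJ (h ▸ hi)
    rw [mem_sympSupport] at hk
    simp [w, bJ, hkJ, hki] at hk
  · rw [transvec_apply, hform, swt_eq_card, swt_eq_card]
    have hsub : sympSupport (b + (1 * 1 : F) • (w + (-1 : F) • bJ)) ⊆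
        insert i (sympSupport b \ J) := by
      intro k hk
      by_cases hki : k = i
      · simp [hki]
      · rw [mem_sympSupport] at hk
        by_cases hkJ : k ∈ J
        · simp [w, bJ, hkJ, hki] at hk
        · simpa [w, bJ, hkJ, hki, mem_sympSupport] using hk
    have h1 := (Finset.card_le_card hsub).trans (Finset.card_insert_le _ _)
    have h2 := Finset.card_sdiff_add_card_eq_card hb
    omega

/-- The decomposition of `F_q^{2(m+n)}` as `F_q^{2m} × F_q^{2n}`. -/
def splitSV (F : Type*) [Field F] (m n : ℕ) : SV F (m + n) ≃+ SV F m × SV F n where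
  toFun v := ((fun i => v.1 (Fin.castAdd n i), fun i => v.2 (Fin.castAdd n i)),
    (fun i => v.1 (Fin.natAdd m i), fun i => v.2 (Fin.natAdd m i)))
  invFun w := (Fin.append w.1.1 w.2.1, Fin.append w.1.2 w.2.2)
  left_inv v := by
    ext i <;> refine Fin.addCases (fun i => ?_) (fun i => ?_) i <;> simp
  right_inv w := by
    ext i <;> simp
  map_add' _ _ := rfl

lemma sympForm_splitSV {m n : ℕ} (u v : SV F (m + n)) :
    sympForm u v = sympForm (splitSV F m n u).1 (splitSV F m n v).1 +
      sympForm (splitSV F m n u).2 (splitSV F m n v).2 := by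
  simp only [sympForm, dotProduct, splitSV, Fin.sum_univ_add, AddEquiv.coe_mk, Equiv.coe_fn_mk]
  ring

lemma swt_splitSV {m n : ℕ} (v : SV F (m + n)) :
    swt v = swt (splitSV F m n v).1 + swt (splitSV F m n v).2 := by
  simp only [swt_eq_card, sympSupport, Finset.card_filter, Fin.sum_univ_add]
  rfl

lemma swt_zero : swt (0 : SV F n) = 0 := by
  simp [swt_eq_card, sympSupport]

lemma swtSet_le {S : Set (SV F n)} {v : SV F n} (hv : v ∈ S) (h0 : v ≠ 0) : swtSet S ≤ swt v :=
  Nat.sInf_le ⟨v, ⟨hv, h0⟩, rfl⟩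

lemma exists_swt_eq_swtSet {S : Set (SV F n)} {v : SV F n} (hv : v ∈ S) (h0 : v ≠ 0) :
    ∃ w ∈ S, w ≠ 0 ∧ swt w = swtSet S := by
  obtain ⟨w, ⟨hw, hw0⟩, h⟩ := Nat.sInf_mem (s := swt '' {v | v ∈ S ∧ v ≠ 0}) ⟨_, v, ⟨hv, h0⟩, rfl⟩
  exact ⟨w, hw, hw0, h⟩

lemma swtSet_eq {S : Set (SV F n)} {d : ℕ} (hS : ∀ v ∈ S, v ≠ 0 → d ≤ swt v) {v : SV F n}
    (hv : v ∈ S) (h0 : v ≠ 0) (hd : swt v = d) : swtSet S = d := by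
  obtain ⟨w, hw, hw0, h⟩ := exists_swt_eq_swtSet hv h0
  exact le_antisymm (hd ▸ swtSet_le hv h0) (h ▸ hS w hw hw0)

lemma ne_zero_of_notMem {C : AddSubgroup (SV F n)} {v : SV F n} (hv : v ∉ C) : v ≠ 0 :=
  fun h => hv (h ▸ C.zero_mem)

lemma card_preimage_splitSV {m n : ℕ} (S : Set (SV F m)) (T : Set (SV F n)) :
    Nat.card (splitSV F m n ⁻¹' S ×ˢ T) = Nat.card S * Nat.card T := by
  rw [Nat.card_preimage_of_injective (splitSV F m n).injective (by simp),
    Nat.card_congr (Equiv.Set.prod S T), Nat.card_prod]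

/-- The direct sum of two additive groups, inside `F_q^{2(m+n)}`. -/
def directSum {m n : ℕ} (C₁ : AddSubgroup (SV F m)) (C₂ : AddSubgroup (SV F n)) :
    AddSubgroup (SV F (m + n)) :=
  (C₁.prod C₂).comap (splitSV F m n).toAddMonoidHom

lemma coe_directSum {m n : ℕ} {C₁ : AddSubgroup (SV F m)} {C₂ : AddSubgroup (SV F n)} :
    (directSum C₁ C₂ : Set (SV F (m + n))) =
      splitSV F m n ⁻¹' (C₁ : Set (SV F m)) ×ˢ (C₂ : Set (SV F n)) := rfl

end SympForm

section Codes

variable {p : ℕ} {F : Type*} [Field F] [Fintype F] [CharP F p] {n : ℕ}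

lemma trSymp_eq_trace (u v : SV F n) :
    trSymp p u v = (letI := ZMod.algebra F p; Algebra.trace (ZMod p) F (sympForm u v)) := rfl

lemma trSymp_swap (u v : SV F n) : trSymp p u v = -trSymp p v u := by
  rw [trSymp_eq_trace, trSymp_eq_trace, sympForm_swap, map_neg]

lemma trSymp_zero_right (u : SV F n) : trSymp p u 0 = 0 := by
  simp [trSymp]

lemma trSymp_transvec (c : F) (u v w : SV F n) :
    trSymp p (transvec c u v) (transvec c u w) = trSymp p v w := by
  rw [trSymp_eq_trace, trSymp_eq_trace, sympForm_transvec]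

lemma trSymp_splitSV {m n : ℕ} (u v : SV F (m + n)) :
    trSymp p u v = trSymp p (splitSV F m n u).1 (splitSV F m n v).1 +
      trSymp p (splitSV F m n u).2 (splitSV F m n v).2 := by
  rw [trSymp_eq_trace, trSymp_eq_trace, trSymp_eq_trace, sympForm_splitSV, map_add]

lemma zero_mem_sdual (S : Set (SV F n)) : (0 : SV F n) ∈ sdual p S := fun w _ => by
  rw [trSymp_swap, trSymp_zero_right, neg_zero]

lemma sdual_preimage_transvec (c : F) (u : SV F n) (S : Set (SV F n)) :
    sdual p (transvec c u ⁻¹' S) = transvec c u ⁻¹' sdual p S := by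
  ext v
  constructor
  · intro h w hw
    obtain ⟨w, rfl⟩ := (transvec c u).surjective w
    rw [trSymp_transvec]
    exact h w hw
  · intro h w hw
    rw [← trSymp_transvec c u]
    exact h _ hw

lemma sdual_preimage_splitSV {m n : ℕ} {S : Set (SV F m)} {T : Set (SV F n)}
    (hS : 0 ∈ S) (hT : 0 ∈ T) :
    sdual p (splitSV F m n ⁻¹' S ×ˢ T) = splitSV F m n ⁻¹' sdual p S ×ˢ sdual p T := by
  ext v
  constructor
  · refine fun h => ⟨fun w hw => ?_, fun w hw => ?_⟩
    · have := h ((splitSV F m n).symm (w, 0)) (by simp [hw, hT])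
      simpa [trSymp_splitSV, trSymp_zero_right] using this
    · have := h ((splitSV F m n).symm (0, w)) (by simp [hw, hS])
      simpa [trSymp_splitSV, trSymp_zero_right] using this
  · rintro ⟨h1, h2⟩ w ⟨hw1, hw2⟩
    rw [trSymp_splitSV, h1 _ hw1, h2 _ hw2, add_zero]

variable (p) in
/-- The group `D = C ∩ C^⊥s` of a subsystem code, as a set. -/
def radical (C : AddSubgroup (SV F n)) : Set (SV F n) :=
  (C : Set (SV F n)) ∩ sdual p (C : Set (SV F n))

lemma zero_mem_radical (C : AddSubgroup (SV F n)) : 0 ∈ radical p C :=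
  ⟨C.zero_mem, zero_mem_sdual _⟩

lemma subset_sdual_radical (C : AddSubgroup (SV F n)) :
    (C : Set (SV F n)) ⊆ sdual p (radical p C) := fun v hv w hw => by
  rw [trSymp_swap, hw.2 v hv, neg_zero]

/-- The conditions on an additive group that determine the parameters `k` and `r`. -/
def HasDims (p : ℕ) {F : Type*} [Field F] [Fintype F] [CharP F p] {n : ℕ} (k r : ℕ)
    (C : AddSubgroup (SV F n)) : Prop :=
  C ≠ ⊥ ∧
  (Fintype.card F ^ k) ^ 2 * (Nat.card C * Nat.card (radical p C)) = Fintype.card F ^ (2 * n) ∧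
  (Fintype.card F ^ r) ^ 2 * Nat.card (radical p C) = Nat.card C

/-- `D^⊥s` has minimum weight at least `d`, and `d` is the weight of a nonzero vector of the set
that determines the distance. -/
def HasPureDist (p : ℕ) {F : Type*} [Field F] [Fintype F] [CharP F p] {n : ℕ} (d : ℕ)
    (C : AddSubgroup (SV F n)) : Prop :=
  (∀ v ∈ sdual p (radical p C), v ≠ 0 → d ≤ swt v) ∧
  ((sdual p (radical p C) = (C : Set (SV F n)) ∧ ∃ v ∈ C, v ≠ 0 ∧ swt v = d) ∨
    ∃ v ∈ sdual p (radical p C), v ∉ C ∧ swt v = d)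

lemma isSubsystemCode_and_pureTo_iff {k r d : ℕ} {C : AddSubgroup (SV F n)} :
    (IsSubsystemCode p (Fintype.card F ^ k) (Fintype.card F ^ r) d C ∧ PureTo p d C) ↔
      HasDims p k r C ∧ HasPureDist p d C := by
  constructor
  · rintro ⟨⟨hC, hk, hr, hd⟩, hpure⟩
    refine ⟨⟨hC, hk, hr⟩, fun v hv h0 => hpure.trans (swtSet_le hv h0), ?_⟩
    change d = if sdual p (radical p C) = _ then swtSet (sdual p (radical p C))
      else swtSet (sdual p (radical p C) \ C) at hd
    split_ifs at hd with h
    · obtain ⟨v, hv, h0⟩ := C.bot_or_exists_ne_zero.resolve_left hC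
      obtain ⟨w, hw, hw0, hwd⟩ := exists_swt_eq_swtSet (subset_sdual_radical (p := p) C hv) h0
      rw [← hd] at hwd
      rw [h] at hw
      exact .inl ⟨h, w, hw, hw0, hwd⟩
    · obtain ⟨v, hv, hvC⟩ := Set.exists_of_ssubset
        ((subset_sdual_radical (p := p) C).ssubset_of_ne (Ne.symm h))
      obtain ⟨w, hw, -, hwd⟩ := exists_swt_eq_swtSet (S := sdual p (radical p C) \ C)
        ⟨hv, hvC⟩ (ne_zero_of_notMem hvC)
      exact .inr ⟨w, hw.1, hw.2, hwd.trans hd.symm⟩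
  · rintro ⟨⟨hC, hk, hr⟩, hmin, hwit⟩
    suffices hs : swtSet (sdual p (radical p C)) = d ∧ d =
        if sdual p (radical p C) = (C : Set (SV F n)) then swtSet (sdual p (radical p C))
        else swtSet (sdual p (radical p C) \ C) from
      ⟨⟨hC, hk, hr, hs.2⟩, hs.1.ge⟩
    rcases hwit with ⟨h, v, hv, h0, hvd⟩ | ⟨v, hv, hvC, hvd⟩
    · have := swtSet_eq hmin (subset_sdual_radical C hv) h0 hvd
      rw [if_pos h]
      exact ⟨this, this.symm⟩
    · have h : sdual p (radical p C) ≠ (C : Set (SV F n)) := fun h => hvC (h ▸ hv : v ∈ (C : Set _))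
      rw [if_neg h]
      exact ⟨swtSet_eq hmin hv (ne_zero_of_notMem hvC) hvd,
        (swtSet_eq (S := sdual p (radical p C) \ C) (fun w hw => hmin w hw.1) ⟨hv, hvC⟩
          (ne_zero_of_notMem hvC) hvd).symm⟩

lemma HasPureDist.pos {d : ℕ} {C : AddSubgroup (SV F n)} (h : HasPureDist p d C) : 0 < d := by
  rcases h.2 with ⟨-, v, -, h0, rfl⟩ | ⟨v, -, hvC, rfl⟩
  · exact swt_pos h0
  · exact swt_pos (ne_zero_of_notMem hvC)

lemma radical_comap_transvec (c : F) (u : SV F n) (C : AddSubgroup (SV F n)) :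
    radical p (C.comap (transvec c u).toAddMonoidHom) = transvec c u ⁻¹' radical p C := by
  change (transvec c u ⁻¹' C) ∩ sdual p (transvec c u ⁻¹' C) = _
  rw [sdual_preimage_transvec]
  rfl

lemma HasDims.comap_transvec {k r : ℕ} {C : AddSubgroup (SV F n)} (h : HasDims p k r C)
    (c : F) (u : SV F n) : HasDims p k r (C.comap (transvec c u).toAddMonoidHom) := by
  obtain ⟨hC, hk, hr⟩ := h
  have hcard (S : Set (SV F n)) : Nat.card (transvec c u ⁻¹' S) = Nat.card S :=
    Nat.card_preimage_of_injective (transvec c u).injective (by simp)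
  have hCcard : Nat.card (C.comap (transvec c u).toAddMonoidHom) = Nat.card C := hcard C
  rw [HasDims, radical_comap_transvec, hCcard, hcard]
  refine ⟨fun hbot => hC ?_, hk, hr⟩
  rw [← AddSubgroup.card_eq_one] at hbot ⊢
  rw [← hCcard, hbot]

/-- The distance of a pure code with `D^⊥s ≠ C` can be lowered to any positive value. -/
lemma exists_hasPureDist_of_le {k r d d' : ℕ} {C : AddSubgroup (SV F n)} (hC : HasDims p k r C)
    (hmin : ∀ v ∈ sdual p (radical p C), v ≠ 0 → d ≤ swt v) {b : SV F n}
    (hb : b ∈ sdual p (radical p C)) (hbC : b ∉ C) (hbd : swt b = d) (hpos : 0 < d')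
    (hle : d' ≤ d) :
    ∃ C' : AddSubgroup (SV F n), HasDims p k r C' ∧
      (∀ v ∈ sdual p (radical p C'), v ≠ 0 → d' ≤ swt v) ∧
      ∃ v ∈ sdual p (radical p C'), v ∉ C' ∧ swt v = d' := by
  obtain ⟨J, hJb, hJ⟩ := Finset.exists_subset_card_eq
    (show d + 1 - d' ≤ (sympSupport b).card by rw [← swt_eq_card]; omega)
  have hJne : J.Nonempty := by rw [← Finset.card_pos]; omega
  obtain ⟨u, huJ, hu⟩ := exists_transvec_swt_add_card_le hJne hJb
  have hsymm (v : SV F n) : transvec (-1) u (transvec 1 u v) = v :=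
    (transvec 1 u).symm_apply_apply v
  set e := transvec (-1) u with he
  have hdual : sdual p (radical p (C.comap e.toAddMonoidHom)) =
      e ⁻¹' sdual p (radical p C) := by
    rw [radical_comap_transvec, sdual_preimage_transvec]
  have hmin' : ∀ v ∈ e ⁻¹' sdual p (radical p C), v ≠ 0 → d' ≤ swt v := by
    intro v hv h0
    have h1 := hmin _ hv (by simpa using h0)
    have h2 := swt_lt_swt_transvec_add_card 1 hJne huJ (e v)
    have h3 : transvec 1 u (e v) = v := (transvec 1 u).apply_symm_apply v
    rw [h3] at h2
    omega
  have hb' : transvec 1 u b ∈ e ⁻¹' sdual p (radical p C) := by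
    rw [Set.mem_preimage, hsymm]; exact hb
  have hbC' : transvec 1 u b ∉ C.comap e.toAddMonoidHom := by
    change e (transvec 1 u b) ∉ C
    rwa [hsymm]
  refine ⟨C.comap e.toAddMonoidHom, hC.comap_transvec _ _, hdual ▸ hmin', transvec 1 u b,
    hdual ▸ hb', hbC', ?_⟩
  have := hmin' _ hb' (ne_zero_of_notMem hbC')
  omega

section DirectSum

variable {m : ℕ} {C₁ : AddSubgroup (SV F m)} {C₂ : AddSubgroup (SV F n)}

lemma radical_directSum :
    radical p (directSum C₁ C₂) = splitSV F m n ⁻¹' radical p C₁ ×ˢ radical p C₂ := by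
  rw [radical, coe_directSum, sdual_preimage_splitSV C₁.zero_mem C₂.zero_mem,
    ← Set.preimage_inter, Set.prod_inter_prod]
  rfl

lemma sdual_radical_directSum :
    sdual p (radical p (directSum C₁ C₂)) =
      splitSV F m n ⁻¹' sdual p (radical p C₁) ×ˢ sdual p (radical p C₂) := by
  rw [radical_directSum, sdual_preimage_splitSV (zero_mem_radical _) (zero_mem_radical _)]

lemma HasDims.directSum {k₁ r₁ k₂ r₂ : ℕ} (h₁ : HasDims p k₁ r₁ C₁) (h₂ : HasDims p k₂ r₂ C₂) :
    HasDims p (k₁ + k₂) (r₁ + r₂) (directSum C₁ C₂) := by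
  obtain ⟨hC, hk₁, hr₁⟩ := h₁
  obtain ⟨-, hk₂, hr₂⟩ := h₂
  have hcard : Nat.card (_root_.directSum C₁ C₂) = Nat.card C₁ * Nat.card C₂ :=
    card_preimage_splitSV (C₁ : Set (SV F m)) (C₂ : Set (SV F n))
  rw [HasDims, radical_directSum, card_preimage_splitSV, hcard]
  refine ⟨fun hbot => hC ?_, ?_, ?_⟩
  · rw [← AddSubgroup.card_eq_one] at hbot ⊢
    rw [hcard] at hbot
    exact Nat.eq_one_of_mul_eq_one_right hbot
  · rw [mul_add 2, pow_add _ (2 * m), ← hk₁, ← hk₂]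
    ring
  · conv_rhs => rw [← hr₁, ← hr₂]
    ring

lemma le_swt_of_mem_sdual_radical_directSum {d : ℕ}
    (h₁ : ∀ v ∈ sdual p (radical p C₁), v ≠ 0 → d ≤ swt v)
    (h₂ : ∀ v ∈ sdual p (radical p C₂), v ≠ 0 → d ≤ swt v) :
    ∀ v ∈ sdual p (radical p (directSum C₁ C₂)), v ≠ 0 → d ≤ swt v := by
  intro v hv h0
  rw [sdual_radical_directSum] at hv
  rw [swt_splitSV]
  by_cases hv1 : (splitSV F m n v).1 = 0
  · have hv2 : (splitSV F m n v).2 ≠ 0 := fun hv2 =>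
      h0 ((splitSV F m n).map_eq_zero_iff.1 (Prod.ext hv1 hv2))
    exact (h₂ _ hv.2 hv2).trans (Nat.le_add_left _ _)
  · exact (h₁ _ hv.1 hv1).trans (Nat.le_add_right _ _)

lemma exists_left_witness {d : ℕ}
    (h : ∃ v ∈ sdual p (radical p C₁), v ∉ C₁ ∧ swt v = d) :
    ∃ v ∈ sdual p (radical p (directSum C₁ C₂)), v ∉ directSum C₁ C₂ ∧ swt v = d := by
  obtain ⟨v, hv, hvC, rfl⟩ := h
  refine ⟨(splitSV F m n).symm (v, 0), ?_, ?_, ?_⟩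
  · rw [sdual_radical_directSum]
    simp [hv, zero_mem_sdual]
  · rw [← SetLike.mem_coe, coe_directSum]
    simp [hvC]
  · simp [swt_splitSV, swt_zero]

lemma exists_right_witness {d : ℕ}
    (h : ∃ v ∈ sdual p (radical p C₂), v ∉ C₂ ∧ swt v = d) :
    ∃ v ∈ sdual p (radical p (directSum C₁ C₂)), v ∉ directSum C₁ C₂ ∧ swt v = d := by
  obtain ⟨v, hv, hvC, rfl⟩ := h
  refine ⟨(splitSV F m n).symm (0, v), ?_, ?_, ?_⟩
  · rw [sdual_radical_directSum]
    simp [hv, zero_mem_sdual]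
  · rw [← SetLike.mem_coe, coe_directSum]
    simp [hvC]
  · simp [swt_splitSV, swt_zero]

lemma HasPureDist.directSum_of_eq {d₁ d₂ : ℕ} (h₁ : HasPureDist p d₁ C₁)
    (h₂ : HasPureDist p d₂ C₂) (hE₁ : sdual p (radical p C₁) = C₁)
    (hE₂ : sdual p (radical p C₂) = C₂) : HasPureDist p (min d₁ d₂) (directSum C₁ C₂) := by
  refine ⟨le_swt_of_mem_sdual_radical_directSum
    (fun v hv h0 => (min_le_left _ _).trans (h₁.1 v hv h0))
    (fun v hv h0 => (min_le_right _ _).trans (h₂.1 v hv h0)), .inl ⟨?_, ?_⟩⟩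
  · rw [sdual_radical_directSum, hE₁, hE₂, coe_directSum]
  obtain ⟨v, hv, h0, hvd⟩ : ∃ v ∈ C₁, v ≠ 0 ∧ swt v = d₁ :=
    h₁.2.elim And.right fun ⟨v, hv, hvC, _⟩ => (hvC (hE₁ ▸ hv : v ∈ (C₁ : Set _))).elim
  obtain ⟨w, hw, hw0, hwd⟩ : ∃ v ∈ C₂, v ≠ 0 ∧ swt v = d₂ :=
    h₂.2.elim And.right fun ⟨v, hv, hvC, _⟩ => (hvC (hE₂ ▸ hv : v ∈ (C₂ : Set _))).elim
  simp only [← SetLike.mem_coe, coe_directSum]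
  rcases le_total d₁ d₂ with hle | hle
  · exact ⟨(splitSV F m n).symm (v, 0), by simpa [C₂.zero_mem] using hv, by simpa using h0,
      by simp [swt_splitSV, swt_zero, hvd, hle]⟩
  · exact ⟨(splitSV F m n).symm (0, w), by simpa [C₁.zero_mem] using hw, by simpa using hw0,
      by simp [swt_splitSV, swt_zero, hwd, hle]⟩

end DirectSum

end Codes

/-- Combining pure `[[n₁,k₁,r₁,d₁]]_q` and `[[n₂,k₂,r₂,d₂]]_q` subsystem codes gives a pure
`[[n₁+n₂, k₁+k₂, r₁+r₂, d]]_q` subsystem code with `d ≥ min{d₁,d₂}`. -/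
theorem stmt16 {p : ℕ} [Fact p.Prime] {F : Type} [Field F] [Fintype F] [CharP F p]
    {n₁ n₂ k₁ r₁ d₁ k₂ r₂ d₂ : ℕ}
    (C₁ : AddSubgroup (SV F n₁)) (C₂ : AddSubgroup (SV F n₂))
    (h₁ : IsSubsystemCode p (Fintype.card F ^ k₁) (Fintype.card F ^ r₁) d₁ C₁)
    (hp₁ : PureTo p d₁ C₁)
    (h₂ : IsSubsystemCode p (Fintype.card F ^ k₂) (Fintype.card F ^ r₂) d₂ C₂)
    (hp₂ : PureTo p d₂ C₂) :
    ∃ (C : AddSubgroup (SV F (n₁ + n₂))) (d : ℕ), min d₁ d₂ ≤ d ∧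
      IsSubsystemCode p (Fintype.card F ^ (k₁ + k₂)) (Fintype.card F ^ (r₁ + r₂)) d C ∧
      PureTo p d C := by
  have hiff₁ := isSubsystemCode_and_pureTo_iff.1 ⟨h₁, hp₁⟩
  have hiff₂ := isSubsystemCode_and_pureTo_iff.1 ⟨h₂, hp₂⟩
  obtain ⟨hD₁, hd₁⟩ := hiff₁
  obtain ⟨hD₂, hd₂⟩ := hiff₂
  suffices ∃ C : AddSubgroup (SV F (n₁ + n₂)),
      HasDims p (k₁ + k₂) (r₁ + r₂) C ∧ HasPureDist p (min d₁ d₂) C by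
    obtain ⟨C, hC⟩ := this
    exact ⟨C, min d₁ d₂, le_rfl, isSubsystemCode_and_pureTo_iff.2 hC⟩
  have hpos : 0 < min d₁ d₂ := lt_min hd₁.pos hd₂.pos
  have hmin₁ : ∀ v ∈ sdual p (radical p C₁), v ≠ 0 → min d₁ d₂ ≤ swt v :=
    fun v hv h0 => (min_le_left _ _).trans (hd₁.1 v hv h0)
  have hmin₂ : ∀ v ∈ sdual p (radical p C₂), v ≠ 0 → min d₁ d₂ ≤ swt v :=
    fun v hv h0 => (min_le_right _ _).trans (hd₂.1 v hv h0)
  rcases hd₁.2 with ⟨hE₁, -⟩ | ⟨b, hb, hbC, hbd⟩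
  · rcases hd₂.2 with ⟨hE₂, -⟩ | ⟨b, hb, hbC, hbd⟩
    · exact ⟨directSum C₁ C₂, hD₁.directSum hD₂, hd₁.directSum_of_eq hd₂ hE₁ hE₂⟩
    · obtain ⟨C', hD', hmin', hwit⟩ :=
        exists_hasPureDist_of_le hD₂ hd₂.1 hb hbC hbd hpos (min_le_right _ _)
      exact ⟨directSum C₁ C', hD₁.directSum hD',
        le_swt_of_mem_sdual_radical_directSum hmin₁ hmin', .inr (exists_right_witness hwit)⟩
  · obtain ⟨C', hD', hmin', hwit⟩ :=
      exists_hasPureDist_of_le hD₁ hd₁.1 hb hbC hbd hpos (min_le_left _ _)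
    exact ⟨directSum C' C₂, hD'.directSum hD₂,
      le_swt_of_mem_sdual_radical_directSum hmin' hmin₂, .inr (exists_left_witness hwit)⟩
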